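/- Let G1 be the graph on vertex set {0, 1, ..., 7} whose edge set consists of the edges {i, i+1} for 0 ≤ i ≤ 6, together with {0,7}, {0,4} and {2,6}. Then G1 admits a linear order of its vertices avoiding the pattern P_{ab}, but G1 admits no linear order of its vertices avoiding the pattern P_b. Consequently, the class C_b is strictly contained in the class C_{ab}. -/

import Mathlib

/-- The order given by an injective `f : V → ℝ` avoids the pattern `P_b`
(edges 13 and 24, non-edge 23). -/
def AvoidsPb {V : Type*} (G : SimpleGraph V) (f : V → ℝ) : Prop :=
  ∀ v1 v2 v3 v4 : V, f v1 < f v2 → f v2 < f v3 → f v3 < f v4 →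
    G.Adj v1 v3 → G.Adj v2 v4 → ¬G.Adj v2 v3 → False

/-- The order given by an injective `f : V → ℝ` avoids the pattern `P_{ab}`
(edges 13 and 24, non-edges 12 and 23). -/
def AvoidsPab {V : Type*} (G : SimpleGraph V) (f : V → ℝ) : Prop :=
  ∀ v1 v2 v3 v4 : V, f v1 < f v2 → f v2 < f v3 → f v3 < f v4 →
    G.Adj v1 v3 → G.Adj v2 v4 → ¬G.Adj v1 v2 → ¬G.Adj v2 v3 → False

/-- The class `C_b`: graphs admitting a vertex order avoiding `P_b`. -/
def InCb {V : Type*} (G : SimpleGraph V) : Prop :=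
  ∃ f : V → ℝ, Function.Injective f ∧ AvoidsPb G f

/-- The class `C_{ab}`: graphs admitting a vertex order avoiding `P_{ab}`. -/
def InCab {V : Type*} (G : SimpleGraph V) : Prop :=
  ∃ f : V → ℝ, Function.Injective f ∧ AvoidsPab G f

/-- The graph `G1` on vertices `0, …, 7` with edges `{i, i+1}` for `0 ≤ i ≤ 6`
together with `{0,7}`, `{0,4}` and `{2,6}`. -/
def G1 : SimpleGraph (Fin 8) :=
  SimpleGraph.fromRel (fun i j =>
    (i.val + 1 = j.val) ∨ (i = 0 ∧ j = 7) ∨ (i = 0 ∧ j = 4) ∨ (i = 2 ∧ j = 6))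

theorem InCb.inCab {V : Type*} {G : SimpleGraph V} (h : InCb G) : InCab G := by
  obtain ⟨f, hf, hG⟩ := h
  exact ⟨f, hf, fun v1 v2 v3 v4 h12 h23 h34 h13 h24 _ => hG v1 v2 v3 v4 h12 h23 h34 h13 h24⟩

section InsertionSearch

variable {V : Type*}

/-- Whether the order listed by `l` contains the pattern `P_b` of `G`. -/
def hasPb (G : SimpleGraph V) [DecidableRel G.Adj] (l : List V) : Bool :=
  (l.sublistsLen 4).any fun
    | [a, b, c, d] => decide (G.Adj a c ∧ G.Adj b d ∧ ¬G.Adj b c)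
    | _ => false

/-- Whether every way of inserting the vertices of `todo` one after the other into the order
listed by `cur` leads to the pattern `P_b`. -/
def refutesPb (G : SimpleGraph V) [DecidableRel G.Adj] (todo cur : List V) : Bool :=
  hasPb G cur ||
    match todo with
    | [] => false
    | v :: todo =>
      (List.range (cur.length + 1)).all fun i => refutesPb G todo (cur.take i ++ v :: cur.drop i)

variable {G : SimpleGraph V} [DecidableRel G.Adj] {f : V → ℝ}

theorem AvoidsPb.hasPb_eq_false (hG : AvoidsPb G f) {l : List V}
    (hl : l.Pairwise (f · < f ·)) : hasPb G l = false := by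
  rw [hasPb, List.any_eq_false]
  intro m hm
  have hsub := hl.sublist (List.mem_sublistsLen.1 hm).1
  obtain ⟨a, b, c, d, rfl⟩ := List.length_eq_four.1 (List.mem_sublistsLen.1 hm).2
  simp only [List.pairwise_cons, List.mem_cons, forall_eq_or_imp] at hsub
  rw [decide_eq_true_iff]
  rintro ⟨hac, hbd, hbc⟩
  exact hG a b c d hsub.1.1 hsub.2.1.1 hsub.2.2.1.1 hac hbd hbc

theorem exists_pairwise_insert (hf : Function.Injective f) {v : V} :
    ∀ {l : List V}, l.Pairwise (f · < f ·) → v ∉ l →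
      ∃ i < l.length + 1, (l.take i ++ v :: l.drop i).Pairwise (f · < f ·)
  | [], _, _ => ⟨0, by simp, by simp⟩
  | a :: l, hl, hv => by
    rw [List.mem_cons, not_or] at hv
    have hl' := List.pairwise_cons.1 hl
    rcases lt_or_gt_of_ne (hf.ne hv.1) with h | h
    · refine ⟨0, by simp, ?_⟩
      simp only [List.take_zero, List.drop_zero, List.nil_append, List.pairwise_cons,
        List.mem_cons, forall_eq_or_imp]
      exact ⟨⟨h, fun x hx => h.trans (hl'.1 x hx)⟩, hl'⟩
    · obtain ⟨i, hi, hp⟩ := exists_pairwise_insert hf hl'.2 hv.2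
      refine ⟨i + 1, by simpa using hi, ?_⟩
      simp only [List.take_succ_cons, List.drop_succ_cons, List.cons_append, List.pairwise_cons]
      refine ⟨fun x hx => ?_, hp⟩
      simp only [List.mem_append, List.mem_cons] at hx
      rcases hx with hx | rfl | hx
      · exact hl'.1 x (List.mem_of_mem_take hx)
      · exact h
      · exact hl'.1 x (List.mem_of_mem_drop hx)

theorem AvoidsPb.refutesPb_eq_false (hf : Function.Injective f) (hG : AvoidsPb G f) :
    ∀ {todo cur : List V}, todo.Nodup → todo.Disjoint cur → cur.Pairwise (f · < f ·) →
      refutesPb G todo cur = false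
  | [], cur, _, _, hcur => by simp [refutesPb, hG.hasPb_eq_false hcur]
  | v :: todo, cur, htodo, hdisj, hcur => by
    rw [List.nodup_cons] at htodo
    rw [List.disjoint_cons_left] at hdisj
    obtain ⟨i, hi, hp⟩ := exists_pairwise_insert hf hcur hdisj.1
    rw [refutesPb, hG.hasPb_eq_false hcur, Bool.false_or, List.all_eq_false]
    refine ⟨i, List.mem_range.2 hi, ?_⟩
    rw [Bool.not_eq_true]
    refine hG.refutesPb_eq_false hf htodo.2 ?_ hp
    intro x hx hx'
    simp only [List.mem_append, List.mem_cons] at hx'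
    rcases hx' with hx' | rfl | hx'
    · exact hdisj.2 hx (List.mem_of_mem_take hx')
    · exact htodo.1 hx
    · exact hdisj.2 hx (List.mem_of_mem_drop hx')

theorem not_inCb_of_refutesPb {l : List V} (hl : l.Nodup) (h : refutesPb G l [] = true) :
    ¬InCb G := by
  rintro ⟨f, hf, hG⟩
  simp [hG.refutesPb_eq_false hf hl (List.disjoint_nil_right l) List.Pairwise.nil] at h

end InsertionSearch

instance : DecidableRel G1.Adj := fun i j =>
  decidable_of_iff (i ≠ j ∧
    (((i.val + 1 = j.val) ∨ (i = 0 ∧ j = 7) ∨ (i = 0 ∧ j = 4) ∨ (i = 2 ∧ j = 6)) ∨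
      ((j.val + 1 = i.val) ∨ (j = 0 ∧ i = 7) ∨ (j = 0 ∧ i = 4) ∨ (j = 2 ∧ i = 6)))) Iff.rfl

theorem G1_inCab : InCab G1 := by
  refine ⟨fun i => ((![0, 1, 6, 2, 3, 4, 5, 7] : Fin 8 → ℕ) i : ℝ), ?_, ?_⟩
  · exact Nat.cast_injective.comp (by decide)
  · simp only [AvoidsPab, Nat.cast_lt]
    decide +kernel

theorem G1_not_inCb : ¬InCb G1 :=
  not_inCb_of_refutesPb (l := List.finRange 8) (List.nodup_finRange 8) (by decide +kernel)

/-- `G1` is in `C_{ab}` but not in `C_b`; consequently `C_b ⊊ C_{ab}`. -/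
theorem G1_in_Cab_not_in_Cb :
    InCab G1 ∧
    ¬InCb G1 ∧
    (∀ (V : Type) (_ : Finite V) (G : SimpleGraph V), InCb G → InCab G) ∧
    (∃ (V : Type) (_ : Finite V) (G : SimpleGraph V), InCab G ∧ ¬InCb G) :=
  ⟨G1_inCab, G1_not_inCb, fun _ _ _ => InCb.inCab,
    Fin 8, inferInstance, G1, G1_inCab, G1_not_inCb⟩
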